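/- Let 0 < p ≤ ∞, a ≥ 1, and let A be a subset of a·Ball(L_p^n). Then Σ(A) ≤ (C₁(p)·a·n / v)^{C₂(p)·v}, where v = v(A), C₁(p) = C·(1 + 1/√p) and C₂(p) = 1 + 1/p (with 1/√p = 1/p = 0 when p = ∞), and C is an absolute constant. -/

import Mathlib

open MeasureTheory Filter
open scoped ENNReal NNReal Pointwise BigOperators

/-- The closed octant in `ℝ^n` with vertex `z` and signs `θ`. -/
def octant {n : ℕ} (θ z : Fin n → ℝ) : Set (Fin n → ℝ) :=
  {x | ∀ i, 0 ≤ (x i - z i) * θ i}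

/-- The coordinate convex hull of `A`: what remains of `ℝ^n` after removing all closed
octants disjoint from `A`; equivalently, the points `x` such that every octant containing `x`
intersects `A`. -/
def cconv {n : ℕ} (A : Set (Fin n → ℝ)) : Set (Fin n → ℝ) :=
  {x | ∀ θ z : Fin n → ℝ, (∀ i, θ i = 1 ∨ θ i = -1) → x ∈ octant θ z →
    (octant θ z ∩ A).Nonempty}

/-- The coordinate projection of `ℝ^n` onto `ℝ^σ`. -/
def coordProj {n : ℕ} (σ : Finset (Fin n)) (x : Fin n → ℝ) : Fin n → ℝ :=
  fun i => if i ∈ σ then x i else 0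

/-- The integer cell `a + [0,1]^σ` in `ℝ^σ` (realized inside `ℝ^n` with zero coordinates
off `σ`). -/
def intCell {n : ℕ} (σ : Finset (Fin n)) (a : Fin n → ℤ) : Set (Fin n → ℝ) :=
  {x | (∀ i ∈ σ, (a i : ℝ) ≤ x i ∧ x i ≤ (a i : ℝ) + 1) ∧ ∀ i ∉ σ, x i = 0}

/-- The cell content `Σ(A)`: the total number of integer cells contained in the coordinate
convex hulls of all coordinate projections of `A` (the summand for `σ = ∅` equals `1`
exactly when `A` is nonempty). -/
noncomputable def cellContent {n : ℕ} (A : Set (Fin n → ℝ)) : ℝ≥0∞ :=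
  ∑ σ : Finset (Fin n),
    (({a : Fin n → ℤ | (∀ i ∉ σ, a i = 0) ∧ intCell σ a ⊆ cconv (coordProj σ '' A)}.encard :
      ℕ∞) : ℝ≥0∞)

/-- The covering number `N(K,D)`: the minimal number of translates of `D` needed to cover
`K`. -/
noncomputable def coveringNumber {n : ℕ} (K D : Set (Fin n → ℝ)) : ℕ∞ :=
  ⨅ (m : ℕ) (_ : ∃ x : Fin m → Fin n → ℝ, K ⊆ ⋃ j, (fun y => x j + y) '' D), (m : ℕ∞)

/-- The combinatorial dimension `v(A)` of a set `A ⊆ ℝ^n`: the maximal rank of a coordinate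
projection `P` such that `cconv(PA)` contains an integer cell. -/
noncomputable def combDimSet {n : ℕ} (A : Set (Fin n → ℝ)) : ℝ≥0∞ :=
  ⨆ (σ : Finset (Fin n))
    (_ : ∃ a : Fin n → ℤ, intCell σ a ⊆ cconv (coordProj σ '' A)), (σ.card : ℝ≥0∞)

open Classical in
/-- The unit ball of `L_p` on `{1,…,n}` with the uniform probability measure:
`{x : Σ|x(i)|^p ≤ n}` for finite `p`, and `[-1,1]^n` for `p = ∞`. -/
noncomputable def ballLp (n : ℕ) (p : ℝ≥0∞) : Set (Fin n → ℝ) :=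
  if p = ∞ then {x | ∀ i, |x i| ≤ 1} else {x | ∑ i, |x i| ^ p.toReal ≤ (n : ℝ)}

theorem aux_fact_le (n : ℕ) (hn : 1 ≤ n) :
    (n.factorial : ℝ) ≤ Real.exp 1 * Real.sqrt n * ((n:ℝ) / Real.exp 1) ^ n := by
  obtain ⟨m, rfl⟩ : ∃ m, n = m + 1 := ⟨n - 1, by omega⟩
  have h := Stirling.stirlingSeq'_antitone (Nat.zero_le m)
  simp only [Function.comp, Nat.succ_eq_add_one, zero_add, Stirling.stirlingSeq_one] at h
  rw [Stirling.stirlingSeq, div_le_iff₀ (by positivity)] at h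
  refine h.trans (le_of_eq ?_)
  rw [Real.sqrt_mul (by norm_num)]
  field_simp

theorem aux_gamma (s : ℝ) (hs : 0 < s) :
    Real.Gamma (s + 1) ≤ 2 * Real.exp 1 * (1 + Real.sqrt s) * (s ^ s * Real.exp (-s)) := by
  have key : ∀ n : ℕ, (n:ℝ) ≤ s → s < n + 1 →
      Real.Gamma (s + 1) ≤ n.factorial * ((n:ℝ) + 1) ^ (s - n) := by
    intro n h1 h2
    rcases h1.eq_or_lt with h1 | h1
    · rw [← h1, Real.Gamma_nat_eq_factorial]; simp
    have := Real.Gamma_mul_add_mul_le_rpow_Gamma_mul_rpow_Gamma (s := (n:ℝ) + 1) (t := (n:ℝ) + 1 + 1)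
      (a := 1 - (s - n)) (b := s - n) (by positivity) (by positivity) (by linarith) (by linarith)
      (by ring)
    have e : (1 - (s - n)) * ((n:ℝ) + 1) + (s - n) * ((n:ℝ) + 1 + 1) = s + 1 := by ring
    rw [e, Real.Gamma_add_one (by positivity : (n:ℝ) + 1 ≠ 0), Real.Gamma_nat_eq_factorial] at this
    refine this.trans (le_of_eq ?_)
    have hf : (0:ℝ) < n.factorial := by positivity
    rw [Real.mul_rpow (by positivity) (by positivity), mul_left_comm, ← Real.rpow_add hf]
    simp [mul_comm]
  have hlow : ∀ x : ℝ, 0 < x → x ^ s * Real.exp (-x) ≤ s ^ s * Real.exp (-s) := by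
    intro x hx
    rw [Real.rpow_def_of_pos hx, Real.rpow_def_of_pos hs, ← Real.exp_add, ← Real.exp_add]
    apply Real.exp_le_exp.2
    have := Real.log_le_sub_one_of_pos (div_pos hx hs)
    rw [Real.log_div hx.ne' hs.ne'] at this
    have h2 := mul_le_mul_of_nonneg_left this hs.le
    have : s * (x / s - 1) = x - s := by field_simp
    nlinarith
  have he : Real.exp (-1) * Real.exp 1 = 1 := by rw [← Real.exp_add]; simp
  rcases lt_or_ge s 1 with h | h
  · have h0 := key 0 (by simpa using hs.le) (by simpa using h)
    have h1 := hlow 1 one_pos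
    simp at h0 h1
    refine h0.trans ?_
    have hq : 0 ≤ Real.sqrt s := Real.sqrt_nonneg s
    have hE := Real.exp_pos 1
    have : Real.exp 1 * Real.exp (-1) ≤ Real.exp 1 * (s ^ s * Real.exp (-s)) := by gcongr
    have hX : 0 < Real.exp 1 * (s ^ s * Real.exp (-s)) := by positivity
    nlinarith [mul_nonneg hq hX.le]
  · have hn : 1 ≤ ⌊s⌋₊ := Nat.le_floor (by simpa using h)
    have h0 := key ⌊s⌋₊ (Nat.floor_le hs.le) (Nat.lt_floor_add_one s)
    have hle := Nat.floor_le hs.le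
    have hlt := Nat.lt_floor_add_one s
    generalize ⌊s⌋₊ = n at *
    have hn' : (1:ℝ) ≤ n := by exact_mod_cast hn
    have hn0 : (0:ℝ) < n := by linarith
    have hl := hlow n hn0
    have hf := aux_fact_le n hn
    have hp : ((n:ℝ) + 1) ^ (s - n) ≤ 2 * (n:ℝ) ^ (s - n) := by
      calc ((n:ℝ) + 1) ^ (s - n) ≤ (2 * (n:ℝ)) ^ (s - n) := by
            apply Real.rpow_le_rpow <;> linarith
        _ = 2 ^ (s - n) * (n:ℝ) ^ (s - n) := by rw [Real.mul_rpow] <;> positivity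
        _ ≤ 2 ^ (1:ℝ) * (n:ℝ) ^ (s - n) := by
            gcongr
            · norm_num
            · linarith
        _ = _ := by simp
    have hsq : Real.sqrt n ≤ 1 + Real.sqrt s := by
      have := Real.sqrt_le_sqrt hle
      linarith
    calc _ ≤ _ := h0
      _ ≤ (Real.exp 1 * Real.sqrt n * ((n:ℝ) / Real.exp 1) ^ n) * (2 * (n:ℝ) ^ (s - n)) := by gcongr
      _ = 2 * Real.exp 1 * Real.sqrt n * ((n:ℝ) ^ s * Real.exp (-n)) := by
          rw [Real.rpow_sub hn0, Real.rpow_natCast, div_pow, Real.exp_neg, ← Real.exp_nat_mul]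
          field_simp
      _ ≤ _ := by gcongr

theorem aux_sum (l p : ℝ) (hl : 0 < l) (hp : 0 < p) (N : ℕ) :
    ∑ j ∈ Finset.range N, Real.exp (-l * ((j:ℝ) + 1) ^ p) ≤ l ^ (-1 / p) * Real.Gamma (1 / p + 1) := by
  rw [← integral_exp_neg_mul_rpow hp hl]
  have hanti : AntitoneOn (fun x : ℝ => Real.exp (-l * x ^ p)) (Set.Icc 0 (0 + (N:ℝ))) := by
    intro x hx y hy hxy
    apply Real.exp_le_exp.2
    have := Real.rpow_le_rpow hx.1 hxy hp.le
    nlinarith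
  have h := hanti.sum_le_integral
  simp only [zero_add, Nat.cast_add, Nat.cast_one] at h
  refine h.trans ?_
  rw [intervalIntegral.integral_of_le (by positivity)]
  apply MeasureTheory.setIntegral_mono_set
  · have := integrableOn_rpow_mul_exp_neg_mul_rpow (p := p) (s := 0) (b := l) (by norm_num) hp hl
    simpa using this
  · exact Filter.Eventually.of_forall fun x => (Real.exp_pos _).le
  · exact (Set.Ioc_subset_Ioi_self).eventuallyLE

/-- outer distance of the unit interval `[z, z+1]` to the origin -/
def mOut (z : ℤ) : ℤ := if 0 ≤ z then z + 1 else -z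

theorem aux_sumZ (w : ℤ → ℝ) (N : ℕ) :
    ∑ z ∈ Finset.Ico (-(N:ℤ)) N, w (mOut z) = 2 * ∑ j ∈ Finset.range N, w ((j:ℤ) + 1) := by
  induction N with
  | zero => simp
  | succ N ih =>
    rw [Finset.sum_range_succ, mul_add, ← ih]
    have e : Finset.Ico (-((N+1:ℕ):ℤ)) ((N+1:ℕ):ℤ) =
        insert (-((N:ℤ)+1)) (insert (N:ℤ) (Finset.Ico (-(N:ℤ)) N)) := by
      ext x; simp; omega
    rw [e, Finset.sum_insert (by simp), Finset.sum_insert (by simp)]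
    have e1 : mOut (-((N:ℤ)+1)) = N + 1 := by unfold mOut; split_ifs <;> omega
    have e2 : mOut (N:ℤ) = N + 1 := by unfold mOut; split_ifs <;> omega
    rw [e1, e2]; ring

theorem aux_vertex {n : ℕ} (A : Set (Fin n → ℝ)) (σ : Finset (Fin n)) (c : Fin n → ℤ)
    (h : intCell σ c ⊆ cconv (coordProj σ '' A)) :
    ∃ y ∈ A, ∀ i ∈ σ, (mOut (c i) : ℝ) ≤ |y i| := by
  classical
  let x : Fin n → ℝ := fun i => if i ∈ σ then (if 0 ≤ c i then (c i : ℝ) + 1 else c i) else 0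
  let θ : Fin n → ℝ := fun i => if 0 ≤ c i then 1 else -1
  have hx : x ∈ intCell σ c := by
    refine ⟨fun i hi => ?_, fun i hi => by simp [x, hi]⟩
    simp only [x, hi, if_true]
    split_ifs <;> constructor <;> linarith
  obtain ⟨_, hy1, y, hyA, rfl⟩ := h hx θ x (fun i => by simp only [θ]; split_ifs <;> simp)
    (fun i => by simp)
  refine ⟨y, hyA, fun i hi => ?_⟩
  have := hy1 i
  simp only [coordProj, x, θ, hi, if_true] at this
  unfold mOut
  split_ifs at this ⊢ with h0
  · push_cast
    exact le_trans (by linarith) (le_abs_self _)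
  · push_cast
    exact le_trans (by linarith) (neg_le_abs _)

/-- the set of cells -/
def cellSet {n : ℕ} (A : Set (Fin n → ℝ)) (σ : Finset (Fin n)) : Set (Fin n → ℤ) :=
  {a : Fin n → ℤ | (∀ i ∉ σ, a i = 0) ∧ intCell σ a ⊆ cconv (coordProj σ '' A)}

theorem aux_count {n : ℕ} (S : Set (Fin n → ℤ)) (σ : Finset (Fin n)) (w : ℤ → ℝ) (N : ℕ) (T : ℝ)
    (hw : ∀ z, 0 ≤ w z) (h0 : ∀ c ∈ S, ∀ i ∉ σ, c i = 0)
    (hN : ∀ c ∈ S, ∀ i ∈ σ, mOut (c i) ≤ N)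
    (hT : ∀ c ∈ S, 1 ≤ T * ∏ i ∈ σ, w (mOut (c i))) (hT0 : 0 ≤ T) :
    ((S.encard : ℕ∞) : ℝ≥0∞) ≤
      ENNReal.ofReal (T * (2 * ∑ j ∈ Finset.range N, w ((j:ℤ) + 1)) ^ σ.card) := by
  classical
  let t : Fin n → Finset ℤ := fun i => if i ∈ σ then Finset.Ico (-(N:ℤ)) N else {0}
  have hsub : S ⊆ (Fintype.piFinset t : Set (Fin n → ℤ)) := by
    intro c hc
    simp only [Finset.mem_coe, Fintype.mem_piFinset, t]
    intro i
    split_ifs with hi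
    · have := hN c hc i hi
      unfold mOut at this
      simp only [Finset.mem_Ico]
      split_ifs at this <;> omega
    · simpa using h0 c hc i hi
  have hfin : S.Finite := (Finset.finite_toSet _).subset hsub
  rw [hfin.encard_eq_coe_toFinset_card]
  have hle : ((hfin.toFinset.card : ℕ) : ℝ) ≤
      T * (2 * ∑ j ∈ Finset.range N, w ((j:ℤ) + 1)) ^ σ.card := by
    let g : Fin n → ℤ → ℝ := fun i z => if i ∈ σ then w (mOut z) else 1
    have hg : ∀ i z, 0 ≤ g i z := by
      intro i z; simp only [g]; split_ifs; exacts [hw _, zero_le_one]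
    have hprod : ∀ c : Fin n → ℤ, ∏ i, g i (c i) = ∏ i ∈ σ, w (mOut (c i)) := by
      intro c; simp [g, Finset.prod_ite]
    calc ((hfin.toFinset.card : ℕ) : ℝ) = ∑ c ∈ hfin.toFinset, (1:ℝ) := by simp
      _ ≤ ∑ c ∈ hfin.toFinset, T * ∏ i, g i (c i) := by
          apply Finset.sum_le_sum
          intro c hc
          rw [hprod]
          exact hT c (by simpa using hc)
      _ ≤ ∑ c ∈ Fintype.piFinset t, T * ∏ i, g i (c i) := by
          apply Finset.sum_le_sum_of_subset_of_nonneg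
          · intro c hc; exact hsub (by simpa using hc)
          · intro c _ _
            exact mul_nonneg hT0 (Finset.prod_nonneg fun i _ => hg _ _)
      _ = T * ∏ i, ∑ z ∈ t i, g i z := by
          rw [← Finset.mul_sum, Finset.prod_univ_sum]
      _ = _ := by
          congr 1
          rw [← aux_sumZ]
          have : ∀ i, ∑ z ∈ t i, g i z =
              if i ∈ σ then ∑ z ∈ Finset.Ico (-(N:ℤ)) N, w (mOut z) else 1 := by
            intro i; by_cases hi : i ∈ σ <;> simp [t, g, hi]
          simp [this, Finset.prod_ite]
  have := ENNReal.ofReal_le_ofReal hle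
  simpa using this

theorem aux_mOut_pos (z : ℤ) : 1 ≤ mOut z := by unfold mOut; split_ifs <;> omega

theorem aux_inf {n : ℕ} (A : Set (Fin n → ℝ)) (a : ℝ) (ha : 1 ≤ a)
    (hA : ∀ y ∈ A, ∀ i, |y i| ≤ a) (σ : Finset (Fin n)) :
    ((cellSet A σ).encard : ℝ≥0∞) ≤ ENNReal.ofReal ((2 * a) ^ σ.card) := by
  refine (aux_count (cellSet A σ) σ (fun _ => 1) ⌊a⌋₊ 1 (by simp) (fun c hc => hc.1) ?_
    (by simp) zero_le_one).trans ?_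
  · intro c hc i hi
    obtain ⟨y, hy, h⟩ := aux_vertex A σ c hc.2
    have h1 := (h i hi).trans (hA y hy i)
    have hp := aux_mOut_pos (c i)
    have : (mOut (c i)).toNat ≤ ⌊a⌋₊ := by
      apply Nat.le_floor
      have : (((mOut (c i)).toNat : ℤ) : ℝ) = mOut (c i) := by
        rw [Int.toNat_of_nonneg (by omega)]
      rw [← this] at h1
      exact_mod_cast h1
    omega
  · apply ENNReal.ofReal_le_ofReal
    have := Nat.floor_le (by linarith : 0 ≤ a)
    simp only [one_mul, Finset.sum_const, Finset.card_range, nsmul_eq_mul, mul_one]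
    gcongr

theorem aux_fin {n : ℕ} (A : Set (Fin n → ℝ)) (a p : ℝ) (ha : 1 ≤ a) (hp : 0 < p)
    (hA : ∀ y ∈ A, ∑ i, |y i| ^ p ≤ a ^ p * n) (σ : Finset (Fin n)) (hσ : 1 ≤ σ.card) :
    ((cellSet A σ).encard : ℝ≥0∞) ≤
      ENNReal.ofReal ((4 * Real.exp 1 * (1 + Real.sqrt (1 / p)) * a *
        ((n:ℝ) / σ.card) ^ (1 / p)) ^ σ.card) := by
  have hn : 1 ≤ n := hσ.trans (by simpa using Finset.card_le_univ σ)
  set k := σ.card with hk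
  have hn0 : (0:ℝ) < n := by exact_mod_cast hn
  have hk0 : (0:ℝ) < k := by exact_mod_cast hσ
  have ha0 : 0 < a := by linarith
  set R := a ^ p * n with hR
  have hR0 : 0 < R := by positivity
  set s := 1 / p with hs
  have hs0 : 0 < s := by positivity
  set l := k * s / R with hl
  have hl0 : 0 < l := by positivity
  have hsum : ∀ c ∈ cellSet A σ, ∑ i ∈ σ, (mOut (c i) : ℝ) ^ p ≤ R := by
    intro c hc
    obtain ⟨y, hy, h⟩ := aux_vertex A σ c hc.2
    calc _ ≤ ∑ i ∈ σ, |y i| ^ p := by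
          apply Finset.sum_le_sum
          intro i hi
          have := aux_mOut_pos (c i)
          apply Real.rpow_le_rpow _ (h i hi) hp.le
          exact_mod_cast (by omega : 0 ≤ mOut (c i))
      _ ≤ ∑ i, |y i| ^ p :=
          Finset.sum_le_sum_of_subset_of_nonneg (Finset.subset_univ _) fun i _ _ => by positivity
      _ ≤ R := hA y hy
  refine (aux_count (cellSet A σ) σ (fun z => Real.exp (-l * (z:ℝ) ^ p)) ⌊R ^ s⌋₊
    (Real.exp (l * R)) (fun _ => (Real.exp_pos _).le) (fun c hc => hc.1) ?_ ?_
    (Real.exp_pos _).le).trans ?_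
  · intro c hc i hi
    have hp1 := aux_mOut_pos (c i)
    have hpos : ∀ j, (0:ℝ) ≤ mOut (c j) := fun j => by
      have := aux_mOut_pos (c j)
      exact_mod_cast (by omega : 0 ≤ mOut (c j))
    have h1 : (mOut (c i) : ℝ) ^ p ≤ R :=
      (Finset.single_le_sum (f := fun i => (mOut (c i) : ℝ) ^ p)
        (fun j _ => Real.rpow_nonneg (hpos j) p) hi).trans (hsum c hc)
    have h1 : (mOut (c i) : ℝ) ≤ R ^ s := by
      have := Real.rpow_le_rpow (Real.rpow_nonneg (hpos i) p) h1 hs0.le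
      rwa [← Real.rpow_mul (hpos i), hs, mul_one_div_cancel hp.ne', Real.rpow_one] at this
    have : (mOut (c i)).toNat ≤ ⌊R ^ s⌋₊ := by
      apply Nat.le_floor
      have : (((mOut (c i)).toNat : ℤ) : ℝ) = mOut (c i) := by
        rw [Int.toNat_of_nonneg (by omega)]
      rw [← this] at h1
      exact_mod_cast h1
    omega
  · intro c hc
    rw [← Real.exp_sum, ← Real.exp_add, ← Finset.mul_sum]
    apply Real.one_le_exp
    have := mul_le_mul_of_nonneg_left (hsum c hc) hl0.le
    linarith
  · apply ENNReal.ofReal_le_ofReal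
    have hlR : l * R = s * k := by rw [hl]; field_simp
    rw [hlR, mul_comm s, Real.exp_nat_mul, ← mul_pow]
    have h1 := aux_sum l p hl0 hp ⌊R ^ s⌋₊
    have h2 := aux_gamma s hs0
    have h3 : l ^ (-1 / p) = a * ((n:ℝ) / k) ^ s * s ^ (-s) := by
      have e1 : (-1) / p = -s := by rw [hs]; ring
      have e2 : l = (a ^ p)⁻¹ * ((n:ℝ) / k)⁻¹ * s := by
        rw [hl, hR]; field_simp
      rw [e1, e2, Real.mul_rpow (by positivity) (by positivity),
        Real.mul_rpow (by positivity) (by positivity), Real.inv_rpow (by positivity),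
        Real.inv_rpow (by positivity), Real.rpow_neg (by positivity), Real.rpow_neg (by positivity),
        inv_inv, inv_inv, ← Real.rpow_mul ha0.le, hs, mul_one_div_cancel hp.ne', Real.rpow_one]
    push_cast
    apply pow_le_pow_left₀
    · positivity
    calc Real.exp s * (2 * ∑ j ∈ Finset.range ⌊R ^ s⌋₊, Real.exp (-l * ((j:ℝ) + 1) ^ p))
        ≤ Real.exp s * (2 * (a * ((n:ℝ) / k) ^ s * s ^ (-s) *
            (2 * Real.exp 1 * (1 + Real.sqrt s) * (s ^ s * Real.exp (-s))))) := by
          gcongr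
          refine h1.trans ?_
          rw [h3]
          gcongr
      _ = (4 * Real.exp 1 * (1 + Real.sqrt s) * a * ((n:ℝ) / k) ^ s) *
            ((Real.exp s * Real.exp (-s)) * (s ^ (-s) * s ^ s)) := by ring
      _ = _ := by
          rw [← Real.exp_add, ← Real.rpow_add hs0]; simp

theorem aux_mono (M : ℝ) (k v : ℕ) (hkv : k ≤ v) (hv : 1 ≤ v) (hM : Real.exp 1 * v ≤ M) :
    (M / k) ^ k ≤ (M / v) ^ v := by
  have hv0 : (0:ℝ) < v := by exact_mod_cast hv
  have hE : 1 ≤ Real.exp 1 := Real.one_le_exp (by norm_num)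
  have hMv : Real.exp 1 ≤ M / v := by rwa [le_div_iff₀ hv0]
  rcases Nat.eq_zero_or_pos k with rfl | hk
  · simpa using one_le_pow₀ (hE.trans hMv)
  have hk0 : (0:ℝ) < k := by exact_mod_cast hk
  have hM0 : 0 < M := by nlinarith
  obtain ⟨d, rfl⟩ := Nat.exists_eq_add_of_le hkv
  have h1 : (((k + d : ℕ):ℝ) / k) ^ k ≤ (M / ((k + d : ℕ):ℝ)) ^ d := by
    calc (((k + d : ℕ):ℝ) / k) ^ k ≤ (Real.exp ((d:ℝ) / k)) ^ k := by
          gcongr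
          have := Real.add_one_le_exp ((d:ℝ) / k)
          refine le_trans (le_of_eq ?_) this
          push_cast; field_simp; ring
      _ = Real.exp 1 ^ d := by
          rw [← Real.exp_nat_mul, ← Real.exp_nat_mul]; congr 1; field_simp
      _ ≤ _ := by gcongr
  calc (M / k) ^ k = (M / ((k + d : ℕ):ℝ)) ^ k * (((k + d : ℕ):ℝ) / k) ^ k := by
        rw [← mul_pow]; congr 1; field_simp
    _ ≤ (M / ((k + d : ℕ):ℝ)) ^ k * (M / ((k + d : ℕ):ℝ)) ^ d := by gcongr
    _ = _ := by rw [← pow_add]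

theorem aux_choose (n k : ℕ) : (n.choose k : ℝ) ≤ (Real.exp 1 * n / k) ^ k := by
  rcases Nat.eq_zero_or_pos k with rfl | hk
  · simp
  have hk0 : (0:ℝ) < k := by exact_mod_cast hk
  refine (Nat.choose_le_pow_div k n).trans ?_
  have h := Real.pow_div_factorial_le_exp (k:ℝ) hk0.le k
  have e : Real.exp (k:ℝ) = Real.exp 1 ^ k := by rw [← Real.exp_nat_mul]; simp
  rw [e, div_le_iff₀ (by positivity)] at h
  rw [div_pow, mul_pow, div_le_div_iff₀ (by positivity) (by positivity)]
  calc (n:ℝ) ^ k * (k:ℝ) ^ k ≤ (n:ℝ) ^ k * (Real.exp 1 ^ k * k.factorial) := by gcongr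
    _ = _ := by ring

theorem aux_term (n k v : ℕ) (D s : ℝ) (hD : 1 ≤ D) (hs : 0 ≤ s) (hkv : k ≤ v) (hv : 1 ≤ v)
    (hvn : v ≤ n) :
    (n.choose k : ℝ) * (D * ((n:ℝ) / k) ^ s) ^ k ≤
      (Real.exp 1 * D * n / v) ^ ((1 + s) * v) := by
  have hE : 1 ≤ Real.exp 1 := Real.one_le_exp (by norm_num)
  have hv0 : (0:ℝ) < v := by exact_mod_cast hv
  have hvn' : (v:ℝ) ≤ n := by exact_mod_cast hvn
  have hmono := aux_mono (Real.exp 1 * D * n) k v hkv hv (by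
    have : (v:ℝ) ≤ D * n := by nlinarith
    nlinarith)
  have hB : (0:ℝ) ≤ Real.exp 1 * D * n / k := by positivity
  calc (n.choose k : ℝ) * (D * ((n:ℝ) / k) ^ s) ^ k
      ≤ (Real.exp 1 * n / k) ^ k * (D * (Real.exp 1 * D * n / k) ^ s) ^ k := by
        gcongr
        · exact aux_choose n k
        · have : 1 ≤ Real.exp 1 * D := by nlinarith
          nlinarith [(Nat.cast_nonneg n : (0:ℝ) ≤ n)]
    _ = (Real.exp 1 * D * n / k) ^ k * ((Real.exp 1 * D * n / k) ^ k) ^ s := by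
        rw [← Real.rpow_natCast (_ / _) k, ← Real.rpow_natCast (_ / _) k, ← Real.rpow_mul hB,
          mul_comm (k:ℝ) s, Real.rpow_mul hB, Real.rpow_natCast, Real.rpow_natCast, Real.rpow_natCast,
          ← mul_pow, ← mul_pow]
        congr 1; ring
    _ ≤ (Real.exp 1 * D * n / v) ^ v * ((Real.exp 1 * D * n / v) ^ v) ^ s := by
        gcongr
    _ = _ := by
        have hp : 0 < Real.exp 1 * D * n / v := by
          have : (0:ℝ) < n := by linarith
          positivity
        rw [← Real.rpow_natCast, ← Real.rpow_mul hp.le, ← Real.rpow_add hp]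
        congr 1; ring

theorem aux_total (n v : ℕ) (D s : ℝ) (hD : 1 ≤ D) (hs : 0 ≤ s) (hvn : v ≤ n) :
    ∑ k ∈ Finset.range (v + 1), (n.choose k : ℝ) * (D * ((n:ℝ) / k) ^ s) ^ k ≤
      (2 * Real.exp 1 * D * n / v) ^ ((1 + s) * v) := by
  rcases Nat.eq_zero_or_pos v with rfl | hv
  · simp
  have hX : (0:ℝ) ≤ Real.exp 1 * D * n / v := by positivity
  calc _ ≤ ∑ k ∈ Finset.range (v + 1), (Real.exp 1 * D * n / v) ^ ((1 + s) * v) := by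
        apply Finset.sum_le_sum
        intro k hk
        exact aux_term n k v D s hD hs (by simpa [Nat.lt_succ_iff] using hk) hv hvn
    _ = ((v:ℝ) + 1) * (Real.exp 1 * D * n / v) ^ ((1 + s) * v) := by simp
    _ ≤ 2 ^ ((1 + s) * v) * (Real.exp 1 * D * n / v) ^ ((1 + s) * v) := by
        gcongr
        calc (v:ℝ) + 1 ≤ 2 ^ v := by exact_mod_cast (Nat.lt_two_pow_self (n := v))
          _ = (2:ℝ) ^ (v:ℝ) := (Real.rpow_natCast 2 v).symm
          _ ≤ _ := by
            apply Real.rpow_le_rpow_of_exponent_le (by norm_num)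
            nlinarith [(Nat.cast_nonneg v : (0:ℝ) ≤ v)]
    _ = _ := by
        rw [← Real.mul_rpow (by norm_num) hX]; congr 1; ring

theorem aux_dim {n : ℕ} (A : Set (Fin n → ℝ)) : ∃ v : ℕ, v ≤ n ∧ combDimSet A = v ∧
    ∀ σ : Finset (Fin n), (cellSet A σ).Nonempty → σ.card ≤ v := by
  classical
  let F := Finset.univ.filter fun σ : Finset (Fin n) =>
    ∃ a : Fin n → ℤ, intCell σ a ⊆ cconv (coordProj σ '' A)
  refine ⟨F.sup Finset.card, ?_, le_antisymm ?_ ?_, ?_⟩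
  · apply Finset.sup_le
    intro σ _
    simpa using Finset.card_le_univ σ
  · refine iSup₂_le fun σ h => ?_
    exact_mod_cast Finset.le_sup (f := Finset.card) (show σ ∈ F by simpa [F] using h)
  · rcases F.eq_empty_or_nonempty with h | h
    · simp [h]
    · obtain ⟨σ, hσ, e⟩ := Finset.exists_mem_eq_sup F h Finset.card
      rw [e]
      exact le_iSup₂_of_le (f := fun (σ : Finset (Fin n))
        (_ : ∃ a : Fin n → ℤ, intCell σ a ⊆ cconv (coordProj σ '' A)) => (σ.card : ℝ≥0∞))
        σ (by simpa [F] using hσ) le_rfl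
  · rintro σ ⟨a, ha⟩
    exact Finset.le_sup (f := Finset.card) (show σ ∈ F by simpa [F] using ⟨a, ha.2⟩)

theorem aux_main {n : ℕ} (A : Set (Fin n → ℝ)) (D s : ℝ) (hD : 1 ≤ D) (hs : 0 ≤ s)
    (h : ∀ σ : Finset (Fin n), 1 ≤ σ.card → ((cellSet A σ).encard : ℝ≥0∞) ≤
      ENNReal.ofReal ((D * ((n:ℝ) / σ.card) ^ s) ^ σ.card)) :
    cellContent A ≤ ENNReal.ofReal ((2 * Real.exp 1 * D * n / (combDimSet A).toReal) ^
      ((1 + s) * (combDimSet A).toReal)) := by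
  obtain ⟨v, hvn, hv, hσv⟩ := aux_dim A
  rw [hv, ENNReal.toReal_natCast]
  refine le_trans ?_ (ENNReal.ofReal_le_ofReal (aux_total n v D s hD hs hvn))
  let f : ℕ → ℝ := fun k => if k ≤ v then (D * ((n:ℝ) / k) ^ s) ^ k else 0
  have hf : ∀ k, 0 ≤ f k := by
    intro k; simp only [f]; split_ifs <;> positivity
  have h1 : cellContent A ≤ ∑ σ : Finset (Fin n), ENNReal.ofReal (f σ.card) := by
    apply Finset.sum_le_sum
    intro σ _
    change ((cellSet A σ).encard : ℝ≥0∞) ≤ _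
    rcases (cellSet A σ).eq_empty_or_nonempty with he | hne
    · simp [he]
    have hle := hσv σ hne
    simp only [f, hle, if_true]
    rcases Nat.eq_zero_or_pos σ.card with h0 | h0
    · have hσ : σ = ∅ := Finset.card_eq_zero.1 h0
      subst hσ
      have : (cellSet A ∅).encard ≤ 1 := by
        rw [Set.encard_le_one_iff]
        intro a b ha hb
        funext i
        rw [ha.1 i (by simp), hb.1 i (by simp)]
      have h2 : ((cellSet A ∅).encard : ℝ≥0∞) ≤ ((1 : ℕ∞) : ℝ≥0∞) := ENat.toENNReal_le.2 this
      simpa using h2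
    · exact h σ h0
  refine h1.trans ?_
  rw [← ENNReal.ofReal_sum_of_nonneg (fun _ _ => hf _)]
  apply ENNReal.ofReal_le_ofReal
  have e := Finset.sum_powerset_apply_card f (x := (Finset.univ : Finset (Fin n)))
  rw [Finset.powerset_univ] at e
  rw [e, Finset.card_univ, Fintype.card_fin]
  refine le_of_eq ?_
  symm
  apply Finset.sum_subset_zero_on_sdiff
  · intro k; simp; omega
  · intro k hk
    simp at hk
    simp only [f]
    rw [if_neg (by omega)]; simp
  · intro k hk
    simp at hk
    simp only [f]
    rw [if_pos (by omega)]; simp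

open Classical in
/-- If `A ⊆ a·Ball(L_p^n)` with `0 < p ≤ ∞` and `a ≥ 1`, then
`Σ(A) ≤ (C₁(p)·a·n/v)^{C₂(p)·v}` where `v = v(A)`, `C₁(p) = C(1 + 1/√p)`,
`C₂(p) = 1 + 1/p` (with `1/√p = 1/p = 0` for `p = ∞`). -/
theorem cellContent_le_of_bounded_Lp :
    ∃ C > (0 : ℝ), ∀ (n : ℕ) (p : ℝ≥0∞) (a : ℝ) (A : Set (Fin n → ℝ)),
      0 < p → 1 ≤ a → A ⊆ a • ballLp n p →
      cellContent A ≤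
        ENNReal.ofReal
          ((C * (1 + (if p = ∞ then 0 else 1 / Real.sqrt p.toReal)) * a * n /
              (combDimSet A).toReal) ^
            ((1 + (if p = ∞ then 0 else 1 / p.toReal)) * (combDimSet A).toReal)) := by
  have hE : 1 ≤ Real.exp 1 := Real.one_le_exp (by norm_num)
  refine ⟨2 * Real.exp 1 * (4 * Real.exp 1), by positivity, ?_⟩
  intro n p a A hp ha hA
  have ha0 : 0 < a := by linarith
  by_cases hpi : p = ∞
  · simp only [hpi, if_true]
    have h := aux_main A (4 * Real.exp 1 * a) 0 (by nlinarith) le_rfl ?_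
    · refine h.trans (le_of_eq ?_)
      congr 3
      ring
    · intro σ _
      refine (aux_inf A a ha ?_ σ).trans ?_
      · intro y hy i
        obtain ⟨u, hu, rfl⟩ := hA hy
        simp only [ballLp, hpi, if_true, Set.mem_setOf_eq] at hu
        simp only [Pi.smul_apply, smul_eq_mul, abs_mul, abs_of_pos ha0]
        nlinarith [hu i]
      · apply ENNReal.ofReal_le_ofReal
        rw [Real.rpow_zero, mul_one]
        gcongr
        linarith
  · simp only [hpi, if_false]
    have hp0 : 0 < p.toReal := ENNReal.toReal_pos hp.ne' hpi
    have e : 1 / Real.sqrt p.toReal = Real.sqrt (1 / p.toReal) := by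
      rw [Real.sqrt_div zero_le_one, Real.sqrt_one]
    rw [e]
    have hq := Real.sqrt_nonneg (1 / p.toReal)
    have h := aux_main A (4 * Real.exp 1 * (1 + Real.sqrt (1 / p.toReal)) * a) (1 / p.toReal) ?_
      (by positivity) ?_
    · refine h.trans (le_of_eq ?_)
      congr 3
      ring
    · have h1 : 1 ≤ 4 * Real.exp 1 * (1 + Real.sqrt (1 / p.toReal)) := by nlinarith
      nlinarith
    · intro σ hσ
      refine aux_fin A a p.toReal ha hp0 ?_ σ hσ
      intro y hy
      obtain ⟨u, hu, rfl⟩ := hA hy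
      simp only [ballLp, hpi, if_false, Set.mem_setOf_eq] at hu
      simp only [Pi.smul_apply, smul_eq_mul, abs_mul, abs_of_pos ha0]
      simp only [Real.mul_rpow ha0.le (abs_nonneg _), ← Finset.mul_sum]
      gcongr
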